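/- For all 1 ≤ i ≤ m and 1 ≤ j ≤ n, the optimal prefix score satisfies the recurrence score(i,j) = max{ score_{g,*}(i,j), score_{*,g}(i,j), score_{φ,*}(i,j) + δ(i,j), score_{*,φ}(i,j) + δ(i,j) }. -/

import Mathlib

open scoped Classical

noncomputable section

namespace TrajSim

/-- Points of `ℝ^d`. -/
abbrev Pt (d : ℕ) := EuclideanSpace ℝ (Fin d)

/-- An edge of the complete directed bipartite graph `G(P,Q)`:
`(true, i, j)` denotes the `P→Q` edge `(p_i, q_j)` and `(false, i, j)` denotes the
`Q→P` edge `(q_j, p_i)`; in both cases the underlying index pair is `(i, j)`. -/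
abbrev Edge (m n : ℕ) := Bool × Fin m × Fin n

/-- Two edges with underlying index pairs `(i,j)` and `(k,l)` cross iff
`(i < k ∧ j > l) ∨ (i > k ∧ j < l)`. -/
def Cross {m n : ℕ} (e f : Edge m n) : Prop :=
  (e.2.1 < f.2.1 ∧ f.2.2 < e.2.2) ∨ (f.2.1 < e.2.1 ∧ e.2.2 < f.2.2)

/-- `p_i` has an outgoing edge in `E`. -/
def OutP {m n : ℕ} (E : Finset (Edge m n)) (i : Fin m) : Prop :=
  ∃ j : Fin n, (true, i, j) ∈ E

/-- `q_j` has an outgoing edge in `E`. -/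
def OutQ {m n : ℕ} (E : Finset (Edge m n)) (j : Fin n) : Prop :=
  ∃ i : Fin m, (false, i, j) ∈ E

/-- A monotone assignment: a set of pairwise non-crossing edges of `G(P,Q)`
with at most one outgoing edge from each point of `P ∪ Q`. -/
def MonotoneAssignment {m n : ℕ} (E : Finset (Edge m n)) : Prop :=
  (∀ e ∈ E, ∀ f ∈ E, ¬ Cross e f) ∧
  (∀ i : Fin m, ∀ j j' : Fin n, (true, i, j) ∈ E → (true, i, j') ∈ E → j = j') ∧
  (∀ j : Fin n, ∀ i i' : Fin m, (false, i, j) ∈ E → (false, i', j) ∈ E → i = i')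

/-- `p_i` is a gap point of `E` (no outgoing edge). -/
def GapP {m n : ℕ} (E : Finset (Edge m n)) (i : Fin m) : Prop := ¬ OutP E i

/-- `q_j` is a gap point of `E` (no outgoing edge). -/
def GapQ {m n : ℕ} (E : Finset (Edge m n)) (j : Fin n) : Prop := ¬ OutQ E j

/-- Gaps of `E` in `P` restricted to indices `< t`, as pairs `(s, e)` of the first and
last index of a maximal contiguous block of gap points among the indices `< t`.
Taking `t = m` gives the usual gaps of `E` in `P`. -/
def gapsPBelow {m n : ℕ} (E : Finset (Edge m n)) (t : ℕ) : Finset (Fin m × Fin m) :=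
  Finset.univ.filter fun g =>
    g.1 ≤ g.2 ∧ (g.2 : ℕ) < t ∧
    (∀ k : Fin m, g.1 ≤ k → k ≤ g.2 → GapP E k) ∧
    (∀ s : Fin m, (s : ℕ) + 1 = (g.1 : ℕ) → ¬ GapP E s) ∧
    (∀ e : Fin m, (e : ℕ) = (g.2 : ℕ) + 1 → (e : ℕ) < t → ¬ GapP E e)

/-- Gaps of `E` in `Q` restricted to indices `< t`. -/
def gapsQBelow {m n : ℕ} (E : Finset (Edge m n)) (t : ℕ) : Finset (Fin n × Fin n) :=
  Finset.univ.filter fun g =>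
    g.1 ≤ g.2 ∧ (g.2 : ℕ) < t ∧
    (∀ k : Fin n, g.1 ≤ k → k ≤ g.2 → GapQ E k) ∧
    (∀ s : Fin n, (s : ℕ) + 1 = (g.1 : ℕ) → ¬ GapQ E s) ∧
    (∀ e : Fin n, (e : ℕ) = (g.2 : ℕ) + 1 → (e : ℕ) < t → ¬ GapQ E e)

/-- Score contributed by an edge `(u,v)`: `1 / (c + ‖u − v‖²)`. -/
def edgeScore {d m n : ℕ} (c : ℝ) (p : Fin m → Pt d) (q : Fin n → Pt d) (e : Edge m n) : ℝ :=
  1 / (c + ‖p e.2.1 - q e.2.2‖ ^ 2)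

/-- The length `|g| = e − s + 1` of a gap `g = (s, e)`. -/
def gapLen {m : ℕ} (g : Fin m × Fin m) : ℕ := (g.2 : ℕ) - (g.1 : ℕ) + 1

/-- Score of `E` where gap terms in `P` are counted only among indices `< tP`
and gap terms in `Q` only among indices `< tQ`. -/
def scoreAux {d m n : ℕ} (a Δ c : ℝ) (p : Fin m → Pt d) (q : Fin n → Pt d)
    (tP tQ : ℕ) (E : Finset (Edge m n)) : ℝ :=
  (∑ e ∈ E, edgeScore c p q e)
    + (∑ g ∈ gapsPBelow E tP, (a + Δ * (gapLen g : ℝ)))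
    + (∑ g ∈ gapsQBelow E tQ, (a + Δ * (gapLen g : ℝ)))

/-- `score(P,Q;E) = Σ_{(u,v)∈E} 1/(c+‖u−v‖²) + Σ_{g∈T(E)} (a + Δ·|g|)`. -/
def score {d m n : ℕ} (a Δ c : ℝ) (p : Fin m → Pt d) (q : Fin n → Pt d)
    (E : Finset (Edge m n)) : ℝ :=
  scoreAux a Δ c p q m n E

/-- The last index of `Fin m` (the index of the last point of a sequence of length `m`). -/
def lastIdx {m : ℕ} (hm : 0 < m) : Fin m := ⟨m - 1, Nat.sub_lt hm Nat.one_pos⟩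

/-- `score(P,Q)`: the maximum of `score(P,Q;E)` over all monotone assignments `E`. -/
def optScore {d m n : ℕ} (a Δ c : ℝ) (p : Fin m → Pt d) (q : Fin n → Pt d) : ℝ :=
  sSup {x : ℝ | ∃ E : Finset (Edge m n), MonotoneAssignment E ∧ x = score a Δ c p q E}

/-- `score_{g,*}`: max score over monotone assignments with the last `P`-point a gap point. -/
def optScoreGStar {d m n : ℕ} (a Δ c : ℝ) (hm : 0 < m)
    (p : Fin m → Pt d) (q : Fin n → Pt d) : ℝ :=
  sSup {x : ℝ | ∃ E : Finset (Edge m n), MonotoneAssignment E ∧ GapP E (lastIdx hm) ∧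
    x = score a Δ c p q E}

/-- `score_{*,g}`: max score over monotone assignments with the last `Q`-point a gap point. -/
def optScoreStarG {d m n : ℕ} (a Δ c : ℝ) (hn : 0 < n)
    (p : Fin m → Pt d) (q : Fin n → Pt d) : ℝ :=
  sSup {x : ℝ | ∃ E : Finset (Edge m n), MonotoneAssignment E ∧ GapQ E (lastIdx hn) ∧
    x = score a Δ c p q E}

/-- `score_{g,g}`: both last points are gap points. -/
def optScoreGG {d m n : ℕ} (a Δ c : ℝ) (hm : 0 < m) (hn : 0 < n)
    (p : Fin m → Pt d) (q : Fin n → Pt d) : ℝ :=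
  sSup {x : ℝ | ∃ E : Finset (Edge m n), MonotoneAssignment E ∧ GapP E (lastIdx hm) ∧
    GapQ E (lastIdx hn) ∧ x = score a Δ c p q E}

/-- `score_{φ,*}`: the last `P`-point has no outgoing edge and contributes no gap term
(gaps in `P` are counted among the first `m−1` points only). -/
def optScorePhiStar {d m n : ℕ} (a Δ c : ℝ) (hm : 0 < m)
    (p : Fin m → Pt d) (q : Fin n → Pt d) : ℝ :=
  sSup {x : ℝ | ∃ E : Finset (Edge m n), MonotoneAssignment E ∧ GapP E (lastIdx hm) ∧
    x = scoreAux a Δ c p q (m - 1) n E}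

/-- `score_{*,φ}`: the last `Q`-point has no outgoing edge and contributes no gap term. -/
def optScoreStarPhi {d m n : ℕ} (a Δ c : ℝ) (hn : 0 < n)
    (p : Fin m → Pt d) (q : Fin n → Pt d) : ℝ :=
  sSup {x : ℝ | ∃ E : Finset (Edge m n), MonotoneAssignment E ∧ GapQ E (lastIdx hn) ∧
    x = scoreAux a Δ c p q m (n - 1) E}

/-- `score_{g,φ}`: last `P`-point a gap point (its gap term counted), last `Q`-point with
no outgoing edge and contributing no gap term. -/
def optScoreGPhi {d m n : ℕ} (a Δ c : ℝ) (hm : 0 < m) (hn : 0 < n)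
    (p : Fin m → Pt d) (q : Fin n → Pt d) : ℝ :=
  sSup {x : ℝ | ∃ E : Finset (Edge m n), MonotoneAssignment E ∧ GapP E (lastIdx hm) ∧
    GapQ E (lastIdx hn) ∧ x = scoreAux a Δ c p q m (n - 1) E}

/-- `score_{φ,g}`: last `P`-point with no outgoing edge and contributing no gap term,
last `Q`-point a gap point (its gap term counted). -/
def optScorePhiG {d m n : ℕ} (a Δ c : ℝ) (hm : 0 < m) (hn : 0 < n)
    (p : Fin m → Pt d) (q : Fin n → Pt d) : ℝ :=
  sSup {x : ℝ | ∃ E : Finset (Edge m n), MonotoneAssignment E ∧ GapP E (lastIdx hm) ∧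
    GapQ E (lastIdx hn) ∧ x = scoreAux a Δ c p q (m - 1) n E}

/-- The prefix of length `i` of a sequence of points. -/
def pre {d m : ℕ} (p : Fin m → Pt d) {i : ℕ} (h : i ≤ m) : Fin i → Pt d :=
  fun k => p (Fin.castLE h k)

theorem outP_insert_last {m n : ℕ} (hm : 0 < m) (E : Finset (Edge m n)) (j : Fin n) (k : Fin m) :
    OutP (insert (true, lastIdx hm, j) E) k ↔ k = lastIdx hm ∨ OutP E k := by
  simp only [OutP, Finset.mem_insert, Prod.mk.injEq, true_and]
  grind

theorem outQ_insert_last {m n : ℕ} (hn : 0 < n) (E : Finset (Edge m n)) (i : Fin m) (k : Fin n) :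
    OutQ (insert (false, i, lastIdx hn) E) k ↔ k = lastIdx hn ∨ OutQ E k := by
  simp only [OutQ, Finset.mem_insert, Prod.mk.injEq, true_and]
  grind

theorem outQ_insert_true {m n : ℕ} (E : Finset (Edge m n)) (x : Fin m × Fin n) (k : Fin n) :
    OutQ (insert (true, x) E) k ↔ OutQ E k := by
  simp [OutQ]

theorem outP_insert_false {m n : ℕ} (E : Finset (Edge m n)) (x : Fin m × Fin n) (k : Fin m) :
    OutP (insert (false, x) E) k ↔ OutP E k := by
  simp [OutP]

theorem le_lastIdx {m : ℕ} (hm : 0 < m) (k : Fin m) : k ≤ lastIdx hm := by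
  simp only [lastIdx, Fin.le_def]
  omega

theorem eq_lastIdx_iff {m : ℕ} (hm : 0 < m) (k : Fin m) : k = lastIdx hm ↔ (k : ℕ) = m - 1 := by
  simp [lastIdx, Fin.ext_iff]

/-- Making the last index a non-gap leaves exactly the blocks among the earlier indices. -/
theorem isBlock_insert_last_iff {m : ℕ} (hm : 0 < m) {O O' : Fin m → Prop}
    (hO : ∀ k, O' k ↔ k = lastIdx hm ∨ O k) (g : Fin m × Fin m) :
    (g.1 ≤ g.2 ∧ (g.2 : ℕ) < m ∧ (∀ k : Fin m, g.1 ≤ k → k ≤ g.2 → ¬ O' k) ∧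
      (∀ s : Fin m, (s : ℕ) + 1 = (g.1 : ℕ) → ¬ ¬ O' s) ∧
      (∀ e : Fin m, (e : ℕ) = (g.2 : ℕ) + 1 → (e : ℕ) < m → ¬ ¬ O' e)) ↔
    (g.1 ≤ g.2 ∧ (g.2 : ℕ) < m - 1 ∧ (∀ k : Fin m, g.1 ≤ k → k ≤ g.2 → ¬ O k) ∧
      (∀ s : Fin m, (s : ℕ) + 1 = (g.1 : ℕ) → ¬ ¬ O s) ∧
      (∀ e : Fin m, (e : ℕ) = (g.2 : ℕ) + 1 → (e : ℕ) < m - 1 → ¬ ¬ O e)) := by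
  obtain ⟨s, e⟩ := g
  simp only [hO, eq_lastIdx_iff, Fin.le_def]
  constructor
  · rintro ⟨hse, -, hgap, hl, hr⟩
    have he := hgap e hse le_rfl
    refine ⟨hse, by omega, fun k h₁ h₂ h => hgap k h₁ h₂ (Or.inr h), fun k hk => ?_,
      fun k hk hkm => ?_⟩
    · have := hl k hk
      have := s.isLt
      grind
    · have := hr k hk k.isLt
      grind
  · rintro ⟨hse, hem, hgap, hl, hr⟩
    refine ⟨hse, e.isLt, fun k h₁ h₂ h => ?_, fun k hk h => hl k hk fun h' => h (Or.inr h'),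
      fun k hk _ h => ?_⟩
    · have := hgap k h₁ h₂
      grind
    · have := hr k hk
      have := k.isLt
      grind

theorem score_insert_true {d m n : ℕ} (a Δ c : ℝ) (p : Fin m → Pt d) (q : Fin n → Pt d)
    (hm : 0 < m) (j : Fin n) {E : Finset (Edge m n)} (hE : GapP E (lastIdx hm)) :
    score a Δ c p q (insert (true, lastIdx hm, j) E) =
      scoreAux a Δ c p q (m - 1) n E + edgeScore c p q (true, lastIdx hm, j) := by
  have hP : gapsPBelow (insert (true, lastIdx hm, j) E) m = gapsPBelow E (m - 1) :=
    Finset.filter_congr fun g _ => isBlock_insert_last_iff hm (outP_insert_last hm E j) g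
  have hQ : gapsQBelow (insert (true, lastIdx hm, j) E) n = gapsQBelow E n :=
    Finset.filter_congr fun g _ => by simp only [GapQ, outQ_insert_true]
  have hmem : (true, lastIdx hm, j) ∉ E := fun h => hE ⟨j, h⟩
  rw [score, scoreAux, scoreAux, hP, hQ, Finset.sum_insert hmem]
  ring

theorem score_insert_false {d m n : ℕ} (a Δ c : ℝ) (p : Fin m → Pt d) (q : Fin n → Pt d)
    (hn : 0 < n) (i : Fin m) {E : Finset (Edge m n)} (hE : GapQ E (lastIdx hn)) :
    score a Δ c p q (insert (false, i, lastIdx hn) E) =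
      scoreAux a Δ c p q m (n - 1) E + edgeScore c p q (false, i, lastIdx hn) := by
  have hQ : gapsQBelow (insert (false, i, lastIdx hn) E) n = gapsQBelow E (n - 1) :=
    Finset.filter_congr fun g _ => isBlock_insert_last_iff hn (outQ_insert_last hn E i) g
  have hP : gapsPBelow (insert (false, i, lastIdx hn) E) m = gapsPBelow E m :=
    Finset.filter_congr fun g _ => by simp only [GapP, outP_insert_false]
  have hmem : (false, i, lastIdx hn) ∉ E := fun h => hE ⟨i, h⟩
  rw [score, scoreAux, scoreAux, hP, hQ, Finset.sum_insert hmem]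
  ring

theorem MonotoneAssignment.mono {m n : ℕ} {E F : Finset (Edge m n)}
    (hF : MonotoneAssignment F) (h : E ⊆ F) : MonotoneAssignment E :=
  ⟨fun e he f hf => hF.1 e (h he) f (h hf),
    fun i j j' h₁ h₂ => hF.2.1 i j j' (h h₁) (h h₂),
    fun j i i' h₁ h₂ => hF.2.2 j i i' (h h₁) (h h₂)⟩

theorem not_cross_last {m n : ℕ} (hm : 0 < m) (hn : 0 < n) (b : Bool) (f : Edge m n) :
    ¬ Cross (b, lastIdx hm, lastIdx hn) f ∧ ¬ Cross f (b, lastIdx hm, lastIdx hn) := by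
  have h₁ := le_lastIdx hm f.2.1
  have h₂ := le_lastIdx hn f.2.2
  simp only [Cross]
  grind

theorem MonotoneAssignment.insert_true {m n : ℕ} (hm : 0 < m) (hn : 0 < n)
    {E : Finset (Edge m n)} (hE : MonotoneAssignment E) (hg : GapP E (lastIdx hm)) :
    MonotoneAssignment (insert (true, lastIdx hm, lastIdx hn) E) := by
  obtain ⟨h₁, h₂, h₃⟩ := hE
  have hc := not_cross_last hm hn true
  have hg' : ∀ j, (true, lastIdx hm, j) ∉ E := fun j h => hg ⟨j, h⟩
  refine ⟨?_, ?_, ?_⟩ <;> simp only [Finset.mem_insert, Prod.mk.injEq] <;> grind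

theorem MonotoneAssignment.insert_false {m n : ℕ} (hm : 0 < m) (hn : 0 < n)
    {E : Finset (Edge m n)} (hE : MonotoneAssignment E) (hg : GapQ E (lastIdx hn)) :
    MonotoneAssignment (insert (false, lastIdx hm, lastIdx hn) E) := by
  obtain ⟨h₁, h₂, h₃⟩ := hE
  have hc := not_cross_last hm hn false
  have hg' : ∀ i, (false, i, lastIdx hn) ∉ E := fun i h => hg ⟨i, h⟩
  refine ⟨?_, ?_, ?_⟩ <;> simp only [Finset.mem_insert, Prod.mk.injEq] <;> grind

/-- If both last points have outgoing edges, one of these edges joins the two last points. -/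
theorem MonotoneAssignment.last_mem {m n : ℕ} (hm : 0 < m) (hn : 0 < n)
    {E : Finset (Edge m n)} (hE : MonotoneAssignment E) (hP : OutP E (lastIdx hm))
    (hQ : OutQ E (lastIdx hn)) :
    (true, lastIdx hm, lastIdx hn) ∈ E ∨ (false, lastIdx hm, lastIdx hn) ∈ E := by
  obtain ⟨j, hj⟩ := hP
  obtain ⟨i, hi⟩ := hQ
  rcases (le_lastIdx hn j).eq_or_lt with rfl | hlt
  · exact Or.inl hj
  rcases (le_lastIdx hm i).eq_or_lt with rfl | hlt'
  · exact Or.inr hi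
  exact absurd (Or.inr ⟨hlt', hlt⟩) (hE.1 _ hj _ hi)

theorem monotoneAssignment_empty {m n : ℕ} : MonotoneAssignment (∅ : Finset (Edge m n)) := by
  simp [MonotoneAssignment]

theorem bddAbove_of_forall_exists_eq {α : Type*} [Finite α] (f : α → ℝ) {s : Set ℝ}
    (hs : ∀ x ∈ s, ∃ y, x = f y) : BddAbove s :=
  ((Set.finite_range f).subset fun x hx => (hs x hx).imp fun _ h => h.symm).bddAbove

theorem score_le_optScore {d m n : ℕ} (a Δ c : ℝ) (p : Fin m → Pt d) (q : Fin n → Pt d)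
    {E : Finset (Edge m n)} (hE : MonotoneAssignment E) :
    score a Δ c p q E ≤ optScore a Δ c p q :=
  le_csSup (bddAbove_of_forall_exists_eq (score a Δ c p q) fun _ ⟨E, _, h⟩ => ⟨E, h⟩)
    ⟨E, hE, rfl⟩

theorem score_le_optScoreGStar {d m n : ℕ} (a Δ c : ℝ) (hm : 0 < m) (p : Fin m → Pt d)
    (q : Fin n → Pt d) {E : Finset (Edge m n)} (hE : MonotoneAssignment E)
    (hg : GapP E (lastIdx hm)) : score a Δ c p q E ≤ optScoreGStar a Δ c hm p q :=
  le_csSup (bddAbove_of_forall_exists_eq (score a Δ c p q) fun _ ⟨E, _, _, h⟩ => ⟨E, h⟩)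
    ⟨E, hE, hg, rfl⟩

theorem score_le_optScoreStarG {d m n : ℕ} (a Δ c : ℝ) (hn : 0 < n) (p : Fin m → Pt d)
    (q : Fin n → Pt d) {E : Finset (Edge m n)} (hE : MonotoneAssignment E)
    (hg : GapQ E (lastIdx hn)) : score a Δ c p q E ≤ optScoreStarG a Δ c hn p q :=
  le_csSup (bddAbove_of_forall_exists_eq (score a Δ c p q) fun _ ⟨E, _, _, h⟩ => ⟨E, h⟩)
    ⟨E, hE, hg, rfl⟩

theorem scoreAux_le_optScorePhiStar {d m n : ℕ} (a Δ c : ℝ) (hm : 0 < m) (p : Fin m → Pt d)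
    (q : Fin n → Pt d) {E : Finset (Edge m n)} (hE : MonotoneAssignment E)
    (hg : GapP E (lastIdx hm)) :
    scoreAux a Δ c p q (m - 1) n E ≤ optScorePhiStar a Δ c hm p q :=
  le_csSup (bddAbove_of_forall_exists_eq (scoreAux a Δ c p q (m - 1) n)
    fun _ ⟨E, _, _, h⟩ => ⟨E, h⟩) ⟨E, hE, hg, rfl⟩

theorem scoreAux_le_optScoreStarPhi {d m n : ℕ} (a Δ c : ℝ) (hn : 0 < n) (p : Fin m → Pt d)
    (q : Fin n → Pt d) {E : Finset (Edge m n)} (hE : MonotoneAssignment E)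
    (hg : GapQ E (lastIdx hn)) :
    scoreAux a Δ c p q m (n - 1) E ≤ optScoreStarPhi a Δ c hn p q :=
  le_csSup (bddAbove_of_forall_exists_eq (scoreAux a Δ c p q m (n - 1))
    fun _ ⟨E, _, _, h⟩ => ⟨E, h⟩) ⟨E, hE, hg, rfl⟩

theorem optScore_eq_max {d m n : ℕ} (a Δ c : ℝ) (hm : 0 < m) (hn : 0 < n)
    (p : Fin m → Pt d) (q : Fin n → Pt d) :
    optScore a Δ c p q =
      max (max (optScoreGStar a Δ c hm p q) (optScoreStarG a Δ c hn p q))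
        (max (optScorePhiStar a Δ c hm p q
            + 1 / (c + ‖p (lastIdx hm) - q (lastIdx hn)‖ ^ 2))
          (optScoreStarPhi a Δ c hn p q
            + 1 / (c + ‖p (lastIdx hm) - q (lastIdx hn)‖ ^ 2))) := by
  have hgapP : GapP (∅ : Finset (Edge m n)) (lastIdx hm) := by simp [GapP, OutP]
  have hgapQ : GapQ (∅ : Finset (Edge m n)) (lastIdx hn) := by simp [GapQ, OutQ]
  apply le_antisymm
  · refine csSup_le ⟨_, ∅, monotoneAssignment_empty, rfl⟩ ?_
    rintro _ ⟨E, hE, rfl⟩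
    by_cases hP : GapP E (lastIdx hm)
    · exact le_max_of_le_left (le_max_of_le_left (score_le_optScoreGStar a Δ c hm p q hE hP))
    by_cases hQ : GapQ E (lastIdx hn)
    · exact le_max_of_le_left (le_max_of_le_right (score_le_optScoreStarG a Δ c hn p q hE hQ))
    rcases hE.last_mem hm hn (not_not.mp hP) (not_not.mp hQ) with h | h
    · refine le_max_of_le_right (le_max_of_le_left ?_)
      have hg : GapP (E.erase (true, lastIdx hm, lastIdx hn)) (lastIdx hm) := by
        rintro ⟨j, hj⟩
        obtain ⟨hne, hj⟩ := Finset.mem_erase.mp hj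
        exact hne (by rw [hE.2.1 _ _ _ hj h])
      rw [← Finset.insert_erase h, score_insert_true a Δ c p q hm _ hg]
      exact add_le_add_left (scoreAux_le_optScorePhiStar a Δ c hm p q
        (hE.mono (Finset.erase_subset _ _)) hg) _
    · refine le_max_of_le_right (le_max_of_le_right ?_)
      have hg : GapQ (E.erase (false, lastIdx hm, lastIdx hn)) (lastIdx hn) := by
        rintro ⟨i, hi⟩
        obtain ⟨hne, hi⟩ := Finset.mem_erase.mp hi
        exact hne (by rw [hE.2.2 _ _ _ hi h])
      rw [← Finset.insert_erase h, score_insert_false a Δ c p q hn _ hg]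
      exact add_le_add_left (scoreAux_le_optScoreStarPhi a Δ c hn p q
        (hE.mono (Finset.erase_subset _ _)) hg) _
  · refine max_le (max_le ?_ ?_) (max_le ?_ ?_)
    · refine csSup_le ⟨_, ∅, monotoneAssignment_empty, hgapP, rfl⟩ ?_
      rintro _ ⟨E, hE, -, rfl⟩
      exact score_le_optScore a Δ c p q hE
    · refine csSup_le ⟨_, ∅, monotoneAssignment_empty, hgapQ, rfl⟩ ?_
      rintro _ ⟨E, hE, -, rfl⟩
      exact score_le_optScore a Δ c p q hE
    · rw [← le_sub_iff_add_le]
      refine csSup_le ⟨_, ∅, monotoneAssignment_empty, hgapP, rfl⟩ ?_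
      rintro _ ⟨E, hE, hg, rfl⟩
      rw [le_sub_iff_add_le]
      exact (score_insert_true a Δ c p q hm (lastIdx hn) hg).ge.trans
        (score_le_optScore a Δ c p q (hE.insert_true hm hn hg))
    · rw [← le_sub_iff_add_le]
      refine csSup_le ⟨_, ∅, monotoneAssignment_empty, hgapQ, rfl⟩ ?_
      rintro _ ⟨E, hE, hg, rfl⟩
      rw [le_sub_iff_add_le]
      exact (score_insert_false a Δ c p q hn (lastIdx hm) hg).ge.trans
        (score_le_optScore a Δ c p q (hE.insert_false hm hn hg))

/-- the recurrence (2) for `score(i,j)`: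
`score(i,j) = max{score_{g,*}(i,j), score_{*,g}(i,j), score_{φ,*}(i,j)+δ(i,j),
score_{*,φ}(i,j)+δ(i,j)}`. -/
theorem score_recurrence
    {d m n : ℕ} (p : Fin m → Pt d) (q : Fin n → Pt d) (a Δ c : ℝ) (hc : 0 < c)
    (i j : ℕ) (hi1 : 1 ≤ i) (him : i ≤ m) (hj1 : 1 ≤ j) (hjn : j ≤ n) :
    optScore a Δ c (pre p him) (pre q hjn) =
      max (max (optScoreGStar a Δ c hi1 (pre p him) (pre q hjn))
               (optScoreStarG a Δ c hj1 (pre p him) (pre q hjn)))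
          (max (optScorePhiStar a Δ c hi1 (pre p him) (pre q hjn)
                  + 1 / (c + ‖p ⟨i - 1, by omega⟩ - q ⟨j - 1, by omega⟩‖ ^ 2))
               (optScoreStarPhi a Δ c hj1 (pre p him) (pre q hjn)
                  + 1 / (c + ‖p ⟨i - 1, by omega⟩ - q ⟨j - 1, by omega⟩‖ ^ 2))) := by
  exact optScore_eq_max a Δ c hi1 hj1 (pre p him) (pre q hjn)

end TrajSim
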